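/- Consider the hardcore model on a finite simple graph G = (V,E) with fugacity λ > 0. Let t ≥ 1 and let S ⊆ V be nonempty with |S| ≤ t. Then for every pinning η on V∖S, the conditional distribution μ^η_S on {0,1}^S satisfies approximate tensorization of variance with constant C = (1+λ)^{t−1}; that is, for every function f : {0,1}^S → ℝ, Var_{μ^η_S} f ≤ (1+λ)^{t−1} · Σ_{v∈S} E[Var_v f], where the conditional variances are taken under μ^η_S. -/

import Mathlib

open scoped BigOperators Classical

noncomputable section

/-- Expectation of `f` under the (finitely supported) density `p`. -/
def pmean {α : Type*} [Fintype α] (p f : α → ℝ) : ℝ := ∑ a, p a * f a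

/-- Variance of `f` under the density `p`. -/
def pvar {α : Type*} [Fintype α] (p f : α → ℝ) : ℝ :=
  pmean p (fun a => (f a - pmean p f) ^ 2)

/-- Entropy of `f` under the density `p` (with the convention `0 log 0 = 0`,
which is automatic since `Real.log 0 = 0`). -/
def pent {α : Type*} [Fintype α] (p f : α → ℝ) : ℝ :=
  pmean p (fun a => f a * Real.log (f a)) - pmean p f * Real.log (pmean p f)

/-- Total variation distance between two densities. -/
def ptv {α : Type*} [Fintype α] (p q : α → ℝ) : ℝ := (1 / 2) * ∑ a, |p a - q a|

variable {V : Type*} [Fintype V] [DecidableEq V]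

/-- `σ : V → Bool` is the indicator of an independent set of `G`. -/
def isIndep (G : SimpleGraph V) (σ : V → Bool) : Prop :=
  ∀ u v, G.Adj u v → ¬(σ u = true ∧ σ v = true)

/-- Hardcore weight: `λ^{|σ|}` on independent-set indicators, `0` otherwise. -/
def hcW (G : SimpleGraph V) (lam : ℝ) (σ : V → Bool) : ℝ :=
  if isIndep G σ then lam ^ (Finset.univ.filter (fun v => σ v = true)).card else 0

/-- The hardcore Gibbs distribution with fugacity `lam` on `G`. -/
def hcMu (G : SimpleGraph V) (lam : ℝ) : (V → Bool) → ℝ :=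
  fun σ => hcW G lam σ / ∑ τ, hcW G lam τ

/-- Probability, under the density `μ`, of agreeing with `η` on the set `Λ`. -/
def prAgree (μ : (V → Bool) → ℝ) (Λ : Finset V) (η : V → Bool) : ℝ :=
  ∑ τ ∈ Finset.univ.filter (fun τ : V → Bool => ∀ v ∈ Λ, τ v = η v), μ τ

/-- The conditional density of `μ` given that the configuration agrees with `σ`
outside the (free) set `B`. -/
def condD (μ : (V → Bool) → ℝ) (B : Finset V) (σ : V → Bool) : (V → Bool) → ℝ :=
  fun τ => if ∀ v, v ∉ B → τ v = σ v
    then μ τ / ∑ τ' ∈ Finset.univ.filter (fun τ' : V → Bool => ∀ v, v ∉ B → τ' v = σ v), μ τ'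
    else 0

/-- The configurations agreeing with `σ` outside the free set `B`. -/
def agreeOff (B : Finset V) (σ : V → Bool) : Finset (V → Bool) :=
  Finset.univ.filter (fun τ : V → Bool => ∀ v, v ∉ B → τ v = σ v)

/-- The unnormalized variance of `f` on the finite set `T` with weights `w`. -/
def weightedVar {α : Type*} (w f : α → ℝ) (T : Finset α) : ℝ :=
  ∑ a ∈ T, w a * (f a - (∑ b ∈ T, w b * f b) / ∑ b ∈ T, w b) ^ 2

theorem mem_agreeOff {B : Finset V} {σ τ : V → Bool} :
    τ ∈ agreeOff B σ ↔ ∀ v, v ∉ B → τ v = σ v := by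
  simp [agreeOff]

theorem sum_agreeOff_update {U : Finset V} {v : V} (hv : v ∉ U) (σ : V → Bool)
    (g : (V → Bool) → ℝ) :
    ∑ τ ∈ agreeOff U (Function.update σ v true), g τ =
      ∑ τ ∈ agreeOff U (Function.update σ v false), g (Function.update τ v true) := by
  refine Finset.sum_bij' (fun τ _ => Function.update τ v false)
    (fun τ _ => Function.update τ v true) ?_ ?_ ?_ ?_ ?_
  · intro τ hτ
    rw [mem_agreeOff] at hτ ⊢
    intro u hu
    by_cases huv : u = v
    · subst huv; simp
    · simpa [huv] using hτ u hu
  · intro τ hτ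
    rw [mem_agreeOff] at hτ ⊢
    intro u hu
    by_cases huv : u = v
    · subst huv; simp
    · simpa [huv] using hτ u hu
  · intro τ hτ
    have := mem_agreeOff.1 hτ v hv
    rw [Function.update_self] at this
    rw [Function.update_idem, ← this, Function.update_eq_self]
  · intro τ hτ
    have := mem_agreeOff.1 hτ v hv
    rw [Function.update_self] at this
    rw [Function.update_idem, ← this, Function.update_eq_self]
  · intro τ hτ
    have := mem_agreeOff.1 hτ v hv
    rw [Function.update_self] at this
    rw [Function.update_idem, ← this, Function.update_eq_self]

theorem sum_agreeOff_insert {U : Finset V} {v : V} (hv : v ∉ U) (σ : V → Bool)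
    (g : (V → Bool) → ℝ) :
    ∑ τ ∈ agreeOff (insert v U) σ, g τ =
      ∑ τ ∈ agreeOff U (Function.update σ v false), g τ +
        ∑ τ ∈ agreeOff U (Function.update σ v true), g τ := by
  rw [← Finset.sum_filter_add_sum_filter_not (agreeOff (insert v U) σ) (fun τ => τ v = false)]
  congr 1
  all_goals
    refine Finset.sum_congr ?_ fun _ _ => rfl
    ext τ
    simp only [Finset.mem_filter, mem_agreeOff, Finset.mem_insert, not_or, Bool.not_eq_false]
    constructor
    · rintro ⟨h, h'⟩ u hu
      by_cases huv : u = v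
      · subst huv; simpa using h'
      · simpa [huv] using h u ⟨huv, hu⟩
    · intro h
      refine ⟨fun u hu => by simpa [hu.1] using h u hu.2, by simpa using h v hv⟩

theorem sum_agreeOff_singleton (v : V) (σ : V → Bool) (g : (V → Bool) → ℝ) :
    ∑ τ ∈ agreeOff {v} σ, g τ =
      g (Function.update σ v false) + g (Function.update σ v true) := by
  have h : ∀ σ : V → Bool, agreeOff ∅ σ = {σ} := fun σ => by
    ext τ; simp [mem_agreeOff, funext_iff]
  rw [← insert_empty_eq, sum_agreeOff_insert (Finset.notMem_empty v), h, h]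
  simp

theorem pmean_condD (w : (V → Bool) → ℝ) (B : Finset V) (σ : V → Bool) (g : (V → Bool) → ℝ) :
    pmean (condD w B σ) g = (∑ τ ∈ agreeOff B σ, w τ * g τ) / ∑ τ ∈ agreeOff B σ, w τ := by
  simp only [pmean, condD, ite_mul, zero_mul, ← Finset.sum_filter]
  rw [Finset.sum_div]
  exact Finset.sum_congr rfl fun _ _ => by rw [agreeOff]; ring

theorem pvar_condD (w : (V → Bool) → ℝ) (B : Finset V) (σ : V → Bool) (f : (V → Bool) → ℝ) :
    pvar (condD w B σ) f = weightedVar w f (agreeOff B σ) / ∑ τ ∈ agreeOff B σ, w τ := by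
  simp only [pvar, pmean_condD, weightedVar]

theorem condD_congr (w : (V → Bool) → ℝ) {B : Finset V} {σ τ : V → Bool}
    (h : τ ∈ agreeOff B σ) : condD w B τ = condD w B σ := by
  rw [mem_agreeOff] at h
  have h' : ∀ ρ : V → Bool, (∀ v, v ∉ B → ρ v = τ v) ↔ ∀ v, v ∉ B → ρ v = σ v :=
    fun ρ => forall₂_congr fun v hv => by rw [h v hv]
  funext ρ
  simp only [condD, h']

theorem hcW_nonneg (G : SimpleGraph V) {lam : ℝ} (hlam : 0 < lam) (σ : V → Bool) :
    0 ≤ hcW G lam σ := by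
  unfold hcW; split_ifs <;> positivity

theorem sum_hcW_pos (G : SimpleGraph V) {lam : ℝ} (hlam : 0 < lam) :
    0 < ∑ τ, hcW G lam τ := by
  refine Finset.sum_pos' (fun τ _ => hcW_nonneg G hlam τ)
    ⟨fun _ => false, Finset.mem_univ _, ?_⟩
  simp [hcW, isIndep]

theorem condD_hcMu (G : SimpleGraph V) {lam : ℝ} (hlam : 0 < lam) :
    condD (hcMu G lam) = condD (hcW G lam) := by
  have hZ := (sum_hcW_pos G hlam).ne'
  funext B σ τ
  simp only [condD, hcMu, ← Finset.sum_div]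
  rw [div_div_div_cancel_right₀ hZ]

theorem isIndep.mono {G : SimpleGraph V} {σ τ : V → Bool} (hτ : isIndep G τ)
    (h : ∀ v, σ v = true → τ v = true) : isIndep G σ :=
  fun u v huv hσ => hτ u v huv ⟨h u hσ.1, h v hσ.2⟩

theorem hcW_update_true (G : SimpleGraph V) (lam : ℝ) {σ : V → Bool} {v : V}
    (hσ : σ v = false) :
    hcW G lam (Function.update σ v true) =
      if isIndep G (Function.update σ v true) then lam * hcW G lam σ else 0 := by
  by_cases h : isIndep G (Function.update σ v true)
  · have h' : isIndep G σ := h.mono fun u hu => by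
      by_cases huv : u = v
      · subst huv; simp
      · simpa [huv] using hu
    have hs : (Finset.univ.filter fun u => Function.update σ v true u = true) =
        insert v (Finset.univ.filter fun u => σ u = true) := by
      ext u
      by_cases huv : u = v
      · subst huv; simp
      · simp [huv]
    have hv : v ∉ Finset.univ.filter fun u => σ u = true := by simp [hσ]
    simp only [hcW, if_pos h, if_pos h']
    rw [hs, Finset.card_insert_of_notMem hv, pow_succ']
  · simp [hcW, h]

theorem hcW_update_true_le (G : SimpleGraph V) {lam : ℝ} (hlam : 0 < lam) {σ : V → Bool} {v : V}
    (hσ : σ v = false) :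
    hcW G lam (Function.update σ v true) ≤ lam * hcW G lam σ := by
  rw [hcW_update_true G lam hσ]
  split_ifs
  · exact le_rfl
  · exact mul_nonneg hlam.le (hcW_nonneg G hlam σ)

/-- The partition function with free set `U` is at most `(1+λ)^{|U|}` times the weight of the
configuration vanishing on `U`. -/
theorem sum_hcW_agreeOff_le (G : SimpleGraph V) {lam : ℝ} (hlam : 0 < lam) (U : Finset V)
    (σ : V → Bool) :
    ∑ τ ∈ agreeOff U σ, hcW G lam τ ≤
      (1 + lam) ^ U.card * hcW G lam (fun u => if u ∈ U then false else σ u) := by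
  induction U using Finset.induction_on generalizing σ with
  | empty =>
    have h : agreeOff ∅ σ = {σ} := by ext τ; simp [mem_agreeOff, funext_iff]
    simp [h]
  | insert v U hv ih =>
    rw [sum_agreeOff_insert hv, sum_agreeOff_update hv]
    have h1 : ∑ τ ∈ agreeOff U (Function.update σ v false),
        hcW G lam (Function.update τ v true) ≤
        lam * ∑ τ ∈ agreeOff U (Function.update σ v false), hcW G lam τ := by
      rw [Finset.mul_sum]
      refine Finset.sum_le_sum fun τ hτ => hcW_update_true_le G hlam ?_
      simpa using mem_agreeOff.1 hτ v hv
    have h2 := ih (Function.update σ v false)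
    have h3 : (fun u => if u ∈ U then false else Function.update σ v false u) =
        fun u => if u ∈ insert v U then false else σ u := by
      funext u
      by_cases huv : u = v
      · subst huv; simp
      · simp [huv]
    rw [h3] at h2
    rw [Finset.card_insert_of_notMem hv, pow_succ]
    nlinarith

theorem weightedVar_le {α : Type*} {w f : α → ℝ} {T : Finset α} (hw : ∀ a ∈ T, 0 ≤ w a) (c : ℝ) :
    weightedVar w f T ≤ ∑ a ∈ T, w a * (f a - c) ^ 2 := by
  have expand : ∀ c : ℝ, ∑ a ∈ T, w a * (f a - c) ^ 2 =
      ∑ a ∈ T, w a * f a ^ 2 - 2 * c * ∑ a ∈ T, w a * f a + c ^ 2 * ∑ a ∈ T, w a := fun c => by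
    simp only [Finset.mul_sum, ← Finset.sum_sub_distrib, ← Finset.sum_add_distrib]
    exact Finset.sum_congr rfl fun _ _ => by ring
  rw [weightedVar, expand, expand]
  set L := ∑ a ∈ T, w a * f a with hL
  rcases (Finset.sum_nonneg hw).eq_or_lt with h0 | hpos
  · have hz := (Finset.sum_eq_zero_iff_of_nonneg hw).1 h0.symm
    have : L = 0 := Finset.sum_eq_zero fun a ha => by rw [hz a ha, zero_mul]
    simp [this, ← h0]
  · obtain ⟨m, hm⟩ : ∃ m, m = L / ∑ a ∈ T, w a := ⟨_, rfl⟩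
    have hLm : L = m * ∑ a ∈ T, w a := by rw [hm]; field_simp
    rw [← hm, hLm]
    nlinarith [mul_nonneg hpos.le (sq_nonneg (m - c))]

theorem weightedVar_nonneg {α : Type*} {w f : α → ℝ} {T : Finset α} (hw : ∀ a ∈ T, 0 ≤ w a) :
    0 ≤ weightedVar w f T :=
  Finset.sum_nonneg fun a ha => mul_nonneg (hw a ha) (sq_nonneg _)

theorem sq_weighted_sum_le {α : Type*} {w : α → ℝ} (f : α → ℝ) {T : Finset α}
    (hw : ∀ a ∈ T, 0 ≤ w a) :
    (∑ a ∈ T, w a * f a) ^ 2 ≤ (∑ a ∈ T, w a) * ∑ a ∈ T, w a * f a ^ 2 :=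
  Finset.sum_sq_le_sum_mul_sum_of_sq_le_mul T hw
    (fun a ha => mul_nonneg (hw a ha) (sq_nonneg _)) fun a _ => le_of_eq (by ring)

theorem sum_mul_sub_sq {α : Type*} {w f : α → ℝ} {T : Finset α} {m : ℝ}
    (hm : ∑ a ∈ T, w a * f a = m * ∑ a ∈ T, w a) (c : ℝ) :
    ∑ a ∈ T, w a * (f a - c) ^ 2 =
      ∑ a ∈ T, w a * (f a - m) ^ 2 + (m - c) ^ 2 * ∑ a ∈ T, w a := by
  have : ∑ a ∈ T, w a * (f a - c) ^ 2 =
      ∑ a ∈ T, w a * (f a - m) ^ 2 + 2 * (m - c) * (∑ a ∈ T, w a * f a - m * ∑ a ∈ T, w a) +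
        (m - c) ^ 2 * ∑ a ∈ T, w a := by
    simp only [Finset.mul_sum, ← Finset.sum_sub_distrib, ← Finset.sum_add_distrib]
    exact Finset.sum_congr rfl fun _ _ => by ring
  rw [this, hm]; ring

/-- Scalar form of the two-block estimate. -/
theorem two_block_scalar {lam A p r K D e d : ℝ} (hlam : 0 < lam) (hp : 0 < p) (hr : 0 ≤ r)
    (hA : p + r ≤ A * p) (hK0 : 0 ≤ K) (hK : (p + r) * p * e ^ 2 ≤ r * K) (hD : p * d ^ 2 ≤ D) :
    (p + r) * p * (e + d) ^ 2 ≤ (r + (1 + lam) * p) * (K + A / (1 + lam) * D) := by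
  have hl : 0 < 1 + lam := by linarith
  have hZ : 0 < r + (1 + lam) * p := by positivity
  have hAD : (p + r) * d ^ 2 ≤ A * D := by
    have hA0 : 0 ≤ A := by
      by_contra! h
      nlinarith [mul_pos hp (neg_pos.2 h)]
    nlinarith [mul_le_mul_of_nonneg_left hD hA0, mul_le_mul_of_nonneg_right hA (sq_nonneg d)]
  have key : (1 + lam) * ((p + r) * p * (e + d) ^ 2) ≤
      (r + (1 + lam) * p) * ((1 + lam) * K + (p + r) * d ^ 2) := by
    rcases hr.eq_or_lt with rfl | hr
    · have he : e = 0 := by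
        by_contra he
        have : 0 < (p + 0) * p * e ^ 2 := by positivity
        linarith
      subst he
      have : 0 ≤ (1 + lam) * p * ((1 + lam) * K) := by positivity
      nlinarith
    · refine le_of_mul_le_mul_left ?_ hr
      have h1 := mul_le_mul_of_nonneg_left hK (mul_pos hZ hl).le
      have h2 : 0 ≤ (p + r) * ((1 + lam) * p * e - r * d) ^ 2 := by positivity
      nlinarith
  have hsplit : (1 + lam) * ((r + (1 + lam) * p) * (K + A / (1 + lam) * D)) =
      (r + (1 + lam) * p) * ((1 + lam) * K + A * D) := by
    field_simp
  refine le_of_mul_le_mul_left ?_ hl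
  rw [hsplit]
  exact key.trans (mul_le_mul_of_nonneg_left (by linarith) hZ.le)

/-- Two-block factorization for a pair `(X, Y)` with `X` binary, where `X = 1` has conditional
odds `λ` given `Y ∈ F`, and is impossible given `Y ∉ F`. -/
theorem two_block {ι : Type*} {T F : Finset ι} (hFT : F ⊆ T) {a : ι → ℝ}
    (g₀ g₁ : ι → ℝ) (ha : ∀ i ∈ T, 0 ≤ a i) {lam A : ℝ} (hlam : 0 < lam)
    (hF : 0 < ∑ i ∈ F, a i) (hA : ∑ i ∈ T, a i ≤ A * ∑ i ∈ F, a i) :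
    ∃ c, ∑ i ∈ T, a i * (g₀ i - c) ^ 2 + lam * ∑ i ∈ F, a i * (g₁ i - c) ^ 2 ≤
      (1 + lam) * (weightedVar a g₀ T + lam * weightedVar a g₁ F) +
        A * (lam / (1 + lam) * ∑ i ∈ F, a i * (g₀ i - g₁ i) ^ 2) := by
  have haF : ∀ i ∈ F, 0 ≤ a i := fun i hi => ha i (hFT hi)
  have haR : ∀ i ∈ T \ F, 0 ≤ a i := fun i hi => ha i (Finset.mem_sdiff.1 hi).1
  have hW : ∑ i ∈ T, a i = ∑ i ∈ F, a i + ∑ i ∈ T \ F, a i := by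
    rw [add_comm, Finset.sum_sdiff hFT]
  have hr := Finset.sum_nonneg haR
  have hV1 := weightedVar_nonneg (f := g₁) haF
  have hV0 := weightedVar_nonneg (f := g₀) ha
  have hm0 : ∑ i ∈ T, a i * g₀ i = (∑ i ∈ T, a i * g₀ i) / (∑ i ∈ T, a i) * ∑ i ∈ T, a i := by
    rw [div_mul_cancel₀]; rw [hW]; positivity
  have hm1 : ∑ i ∈ F, a i * g₁ i = (∑ i ∈ F, a i * g₁ i) / (∑ i ∈ F, a i) * ∑ i ∈ F, a i := by
    rw [div_mul_cancel₀]; exact hF.ne'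
  have hmE : ∑ i ∈ F, a i * g₀ i = (∑ i ∈ F, a i * g₀ i) / (∑ i ∈ F, a i) * ∑ i ∈ F, a i := by
    rw [div_mul_cancel₀]; exact hF.ne'
  rw [weightedVar] at hV0 hV1 ⊢
  rw [weightedVar]
  set m₀ := (∑ i ∈ T, a i * g₀ i) / (∑ i ∈ T, a i)
  set m₁ := (∑ i ∈ F, a i * g₁ i) / (∑ i ∈ F, a i)
  set mE := (∑ i ∈ F, a i * g₀ i) / (∑ i ∈ F, a i)
  set p := ∑ i ∈ F, a i
  set r := ∑ i ∈ T \ F, a i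
  set K := ∑ i ∈ T, a i * (g₀ i - m₀) ^ 2 with hKdef
  set D := ∑ i ∈ F, a i * (g₀ i - g₁ i) ^ 2
  have hK : (p + r) * p * (m₀ - mE) ^ 2 ≤ r * K := by
    have hsumF : ∑ i ∈ F, a i * (g₀ i - m₀) = p * (mE - m₀) := by
      simp only [mul_sub, Finset.sum_sub_distrib, ← Finset.sum_mul]
      rw [hmE]; ring
    have hsumT : ∑ i ∈ T, a i * (g₀ i - m₀) = 0 := by
      simp only [mul_sub, Finset.sum_sub_distrib, ← Finset.sum_mul]
      rw [hm0]; ring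
    have hsumR : ∑ i ∈ T \ F, a i * (g₀ i - m₀) = p * (m₀ - mE) := by
      have := Finset.sum_sdiff (f := fun i => a i * (g₀ i - m₀)) hFT
      linarith
    have h1 := sq_weighted_sum_le (fun i => g₀ i - m₀) haF
    have h2 := sq_weighted_sum_le (fun i => g₀ i - m₀) haR
    simp only [hsumF, hsumR] at h1 h2
    have h1' : p * (m₀ - mE) ^ 2 ≤ ∑ i ∈ F, a i * (g₀ i - m₀) ^ 2 := by
      refine le_of_mul_le_mul_left ?_ hF
      calc p * (p * (m₀ - mE) ^ 2) = (p * (mE - m₀)) ^ 2 := by ring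
        _ ≤ _ := h1
    rw [hKdef, ← Finset.sum_sdiff hFT, mul_add]
    nlinarith [mul_le_mul_of_nonneg_left h1' hr]
  have hD : p * (mE - m₁) ^ 2 ≤ D := by
    have h := sq_weighted_sum_le (fun i => g₀ i - g₁ i) haF
    have hs : ∑ i ∈ F, a i * (g₀ i - g₁ i) = p * (mE - m₁) := by
      simp only [mul_sub, Finset.sum_sub_distrib]
      rw [hmE, hm1]; ring
    simp only [hs] at h
    refine le_of_mul_le_mul_left ?_ hF
    calc p * (p * (mE - m₁) ^ 2) = (p * (mE - m₁)) ^ 2 := by ring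
      _ ≤ _ := h
  have key := two_block_scalar hlam hF hr (hW ▸ hA) hV0 hK hD
  rw [show m₀ - mE + (mE - m₁) = m₀ - m₁ by ring] at key
  have hZ : 0 < r + (1 + lam) * p := by positivity
  refine ⟨((p + r) * m₀ + lam * p * m₁) / (r + (1 + lam) * p), ?_⟩
  rw [sum_mul_sub_sq hm0, sum_mul_sub_sq hm1, hW]
  have h0 : m₀ - ((p + r) * m₀ + lam * p * m₁) / (r + (1 + lam) * p) =
      lam * p * (m₀ - m₁) / (r + (1 + lam) * p) := by
    field_simp; ring
  have h1 : m₁ - ((p + r) * m₀ + lam * p * m₁) / (r + (1 + lam) * p) =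
      (p + r) * (m₁ - m₀) / (r + (1 + lam) * p) := by
    field_simp; ring
  have hbetween : (lam * p * (m₀ - m₁) / (r + (1 + lam) * p)) ^ 2 * (p + r) +
      lam * (((p + r) * (m₁ - m₀) / (r + (1 + lam) * p)) ^ 2 * p) =
      lam * ((p + r) * p * (m₀ - m₁) ^ 2 / (r + (1 + lam) * p)) := by
    field_simp; ring
  rw [h0, h1]
  have hfin := mul_le_mul_of_nonneg_left ((div_le_iff₀' hZ).2 key) hlam.le
  have hAD : lam * (A / (1 + lam) * D) = A * (lam / (1 + lam) * D) := by ring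
  nlinarith [mul_nonneg (mul_pos hlam hlam).le hV1]

/-- The unnormalized expected conditional variance at `v` is at least the contribution of the
configurations in which `v` may be occupied. -/
theorem le_sum_pvar_single (G : SimpleGraph V) {lam : ℝ} (hlam : 0 < lam) {U : Finset V} {v : V}
    (hv : v ∉ U) (σ : V → Bool) (f : (V → Bool) → ℝ) :
    lam / (1 + lam) * ∑ τ ∈ (agreeOff U (Function.update σ v false)).filter
        (fun τ => isIndep G (Function.update τ v true)),
          hcW G lam τ * (f τ - f (Function.update τ v true)) ^ 2 ≤
      ∑ τ ∈ agreeOff (insert v U) σ, hcW G lam τ * pvar (condD (hcW G lam) {v} τ) f := by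
  rw [sum_agreeOff_insert hv, sum_agreeOff_update hv, ← Finset.sum_add_distrib, Finset.sum_filter,
    Finset.mul_sum]
  refine Finset.sum_le_sum fun τ hτ => ?_
  have hτv : τ v = false := by simpa using mem_agreeOff.1 hτ v hv
  have hup : Function.update τ v false = τ := by rw [← hτv, Function.update_eq_self]
  have hw := hcW_nonneg G hlam
  have hnn : 0 ≤ pvar (condD (hcW G lam) {v} τ) f := by
    rw [pvar_condD]
    exact div_nonneg (weightedVar_nonneg fun _ _ => hw _) (Finset.sum_nonneg fun _ _ => hw _)
  rw [condD_congr (hcW G lam) (σ := τ) (τ := Function.update τ v true)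
    (mem_agreeOff.2 fun u hu => by simp at hu; simp [hu])]
  split_ifs with h
  · rw [pvar_condD, weightedVar]
    simp only [sum_agreeOff_singleton, hup, hcW_update_true G lam hτv, if_pos h]
    rcases (hw τ).eq_or_lt with h0 | hpos
    · simp [← h0]
    · refine le_of_eq ?_
      have : 0 < 1 + lam := by linarith
      field_simp
      ring
  · have := mul_nonneg (hw τ) hnn
    have := mul_nonneg (hw (Function.update τ v true)) hnn
    linarith

theorem weightedVar_insert_le (G : SimpleGraph V) {lam : ℝ} (hlam : 0 < lam) {U : Finset V} {v : V}
    (hv : v ∉ U) (σ : V → Bool) (f : (V → Bool) → ℝ) :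
    weightedVar (hcW G lam) f (agreeOff (insert v U) σ) ≤
      (1 + lam) * (weightedVar (hcW G lam) f (agreeOff U (Function.update σ v false)) +
        weightedVar (hcW G lam) f (agreeOff U (Function.update σ v true))) +
      (1 + lam) ^ U.card *
        ∑ τ ∈ agreeOff (insert v U) σ, hcW G lam τ * pvar (condD (hcW G lam) {v} τ) f := by
  have hw := hcW_nonneg G hlam
  have hsingle := le_sum_pvar_single G hlam hv σ f
  set T := agreeOff U (Function.update σ v false) with hT
  set F := T.filter (fun τ => isIndep G (Function.update τ v true)) with hF
  have hsum : ∀ g : (V → Bool) → ℝ,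
      ∑ τ ∈ agreeOff U (Function.update σ v true), hcW G lam τ * g τ =
        lam * ∑ τ ∈ F, hcW G lam τ * g (Function.update τ v true) := fun g => by
    rw [sum_agreeOff_update hv, hF, Finset.sum_filter, Finset.mul_sum]
    refine Finset.sum_congr rfl fun τ hτ => ?_
    rw [hcW_update_true G lam (by simpa using mem_agreeOff.1 hτ v hv)]
    split_ifs <;> ring
  have hsum1 : ∑ τ ∈ agreeOff U (Function.update σ v true), hcW G lam τ =
      lam * ∑ τ ∈ F, hcW G lam τ := by simpa using hsum fun _ => 1
  have hvar1 : weightedVar (hcW G lam) f (agreeOff U (Function.update σ v true)) =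
      lam * weightedVar (hcW G lam) (fun τ => f (Function.update τ v true)) F := by
    rw [weightedVar, hsum, hsum, hsum1, mul_div_mul_left _ _ hlam.ne', weightedVar]
  have hle : ∀ c, weightedVar (hcW G lam) f (agreeOff (insert v U) σ) ≤
      ∑ τ ∈ T, hcW G lam τ * (f τ - c) ^ 2 +
        lam * ∑ τ ∈ F, hcW G lam τ * (f (Function.update τ v true) - c) ^ 2 := fun c => by
    refine (weightedVar_le (fun τ _ => hw τ) c).trans_eq ?_
    rw [sum_agreeOff_insert hv, hsum fun τ => (f τ - c) ^ 2]
  have hA : (1 + lam) ^ U.card * (lam / (1 + lam) *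
      ∑ τ ∈ F, hcW G lam τ * (f τ - f (Function.update τ v true)) ^ 2) ≤ (1 + lam) ^ U.card *
        ∑ τ ∈ agreeOff (insert v U) σ, hcW G lam τ * pvar (condD (hcW G lam) {v} τ) f :=
    mul_le_mul_of_nonneg_left hsingle (by positivity)
  rw [hvar1]
  rcases (Finset.sum_nonneg fun τ (_ : τ ∈ F) => hw τ).eq_or_lt with h0 | hpos
  · have hz := (Finset.sum_eq_zero_iff_of_nonneg fun τ _ => hw τ).1 h0.symm
    have hzero : ∀ g : (V → Bool) → ℝ, ∑ τ ∈ F, hcW G lam τ * g τ = 0 := fun g =>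
      Finset.sum_eq_zero fun τ hτ => by rw [hz τ hτ, zero_mul]
    have h1 := hle ((∑ τ ∈ T, hcW G lam τ * f τ) / ∑ τ ∈ T, hcW G lam τ)
    rw [← weightedVar, hzero fun τ => _] at h1
    rw [hzero fun τ => _] at hA
    have h2 := weightedVar_nonneg (f := f) (T := T) fun τ _ => hw τ
    have h3 := weightedVar_nonneg (f := fun τ => f (Function.update τ v true)) (T := F)
      fun τ _ => hw τ
    nlinarith [mul_nonneg hlam.le h2, mul_nonneg hlam.le h3,
      mul_nonneg hlam.le (mul_nonneg hlam.le h3)]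
  · have hpart : ∑ τ ∈ T, hcW G lam τ ≤ (1 + lam) ^ U.card * ∑ τ ∈ F, hcW G lam τ := by
      refine (sum_hcW_agreeOff_le G hlam U _).trans ?_
      refine mul_le_mul_of_nonneg_left ?_ (by positivity)
      refine Finset.single_le_sum (f := hcW G lam) (fun τ _ => hw τ) ?_
      obtain ⟨τ, hτ⟩ : F.Nonempty := by
        by_contra h
        rw [Finset.not_nonempty_iff_eq_empty.1 h, Finset.sum_empty] at hpos
        exact lt_irrefl _ hpos
      rw [hF, Finset.mem_filter] at hτ ⊢
      refine ⟨mem_agreeOff.2 fun u hu => by simp [hu], hτ.2.mono fun u => ?_⟩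
      by_cases huv : u = v
      · subst huv; simp
      · by_cases huU : u ∈ U
        · simp [huv, huU]
        · simp [huv, huU, mem_agreeOff.1 hτ.1 u huU]
    obtain ⟨c, hc⟩ := two_block (Finset.filter_subset _ T) f
      (fun τ => f (Function.update τ v true)) (fun τ _ => hw τ) hlam hpos hpart
    exact (hle c).trans (hc.trans (by gcongr))

/-- Approximate tensorization for the unnormalized variance. -/
theorem weightedVar_agreeOff_le (G : SimpleGraph V) {lam : ℝ} (hlam : 0 < lam) (S : Finset V)
    (σ : V → Bool) (f : (V → Bool) → ℝ) :
    (1 + lam) * weightedVar (hcW G lam) f (agreeOff S σ) ≤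
      (1 + lam) ^ S.card * ∑ v ∈ S,
        ∑ τ ∈ agreeOff S σ, hcW G lam τ * pvar (condD (hcW G lam) {v} τ) f := by
  have hl : 0 < 1 + lam := by linarith
  induction S using Finset.induction_on generalizing σ with
  | empty =>
    have h : agreeOff ∅ σ = {σ} := by ext τ; simp [mem_agreeOff, funext_iff]
    rw [h, weightedVar]
    simp only [Finset.sum_singleton, Finset.sum_empty, mul_zero]
    by_cases hz : hcW G lam σ = 0
    · simp [hz]
    · rw [mul_div_cancel_left₀ _ hz]; simp
  | insert v U hv ih =>
    rw [Finset.card_insert_of_notMem hv, pow_succ', mul_assoc]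
    refine mul_le_mul_of_nonneg_left ((weightedVar_insert_le G hlam hv σ f).trans ?_) hl.le
    rw [Finset.sum_insert hv]
    simp only [sum_agreeOff_insert hv σ, Finset.sum_add_distrib]
    have h0 := ih (Function.update σ v false)
    have h1 := ih (Function.update σ v true)
    nlinarith

/-- **Approximate tensorization of variance for the hardcore model on a small set.**
For nonempty `S ⊆ V` with `|S| ≤ t` and any pinning `η` on `V ∖ S`, the conditional
hardcore distribution `μ^η_S` satisfies approximate tensorization of variance with
constant `(1+λ)^{t-1}`. -/
theorem hardcore_tensorization_of_variance
    {V : Type*} [Fintype V] [DecidableEq V] (G : SimpleGraph V)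
    (lam : ℝ) (hlam : 0 < lam) (t : ℕ) (ht : 1 ≤ t)
    (S : Finset V) (hSne : S.Nonempty) (hS : S.card ≤ t)
    (η : V → Bool) (hη : 0 < prAgree (hcMu G lam) Sᶜ η)
    (f : (V → Bool) → ℝ) :
    pvar (condD (hcMu G lam) S η) f ≤
      (1 + lam) ^ (t - 1) *
        ∑ v ∈ S, pmean (condD (hcMu G lam) S η)
          (fun σ => pvar (condD (hcMu G lam) {v} σ) f) := by
  rw [condD_hcMu G hlam, pvar_condD]
  have hl : 0 < 1 + lam := by linarith
  have hw := hcW_nonneg G hlam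
  have hE : ∀ v ∈ S, pmean (condD (hcW G lam) S η)
      (fun σ => pvar (condD (hcW G lam) {v} σ) f) =
      (∑ τ ∈ agreeOff S η, hcW G lam τ * pvar (condD (hcW G lam) {v} τ) f) /
        ∑ τ ∈ agreeOff S η, hcW G lam τ := fun v _ => pmean_condD _ _ _ _
  rw [Finset.sum_congr rfl hE, ← Finset.sum_div, ← mul_div_assoc]
  refine div_le_div_of_nonneg_right ?_ (Finset.sum_nonneg fun τ _ => hw τ)
  refine le_of_mul_le_mul_left ((weightedVar_agreeOff_le G hlam S η f).trans ?_) hl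
  rw [← mul_assoc, ← pow_succ', Nat.sub_add_cancel ht]
  refine mul_le_mul_of_nonneg_right (pow_le_pow_right₀ (by linarith) hS) ?_
  refine Finset.sum_nonneg fun v _ => Finset.sum_nonneg fun τ _ => mul_nonneg (hw τ) ?_
  rw [pvar_condD]
  exact div_nonneg (weightedVar_nonneg fun _ _ => hw _) (Finset.sum_nonneg fun _ _ => hw _)

end
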